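/- Let u : ℝ³∖{0} → ℂ⁴ be continuously differentiable. Then for every x ≠ 0, the Dirac operator in polar coordinates satisfies 𝒟u(x) = −i(α·x̂)(∂_r u(x) + u(x)/|x| − (1/|x|)(βK u)(x)), where x̂ = x/|x|, ∂_r u(x) = x̂·∇u(x) is the radial derivative, K = β(2S·L + 1) is the spin orbit operator, L = −i x×∇ is the orbital angular momentum operator (acting componentwise), and 2S·L = Σₖ γ₅αₖLₖ. -/

import Mathlib

noncomputable section

open MeasureTheory Real Complex Filter Matrix
open scoped FourierTransform ENNReal NNReal

attribute [local instance] Matrix.normedAddCommGroup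

/-- Euclidean space `ℝ³`. -/
abbrev R3 : Type := EuclideanSpace ℝ (Fin 3)

/-- Spinors: elements of `ℂ⁴`. -/
abbrev Spinor : Type := Fin 4 → ℂ

/-- The Pauli matrices. -/
def pauli : Fin 3 → Matrix (Fin 2) (Fin 2) ℂ
  | 0 => !![0, 1; 1, 0]
  | 1 => !![0, -Complex.I; Complex.I, 0]
  | 2 => !![1, 0; 0, -1]

/-- The Dirac matrices `αₖ = [[0,σₖ],[σₖ,0]]` in 2×2 block form. -/
def diracAlpha (k : Fin 3) : Matrix (Fin 4) (Fin 4) ℂ :=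
  (Matrix.reindex finSumFinEquiv finSumFinEquiv
    (Matrix.fromBlocks 0 (pauli k) (pauli k) 0) : Matrix (Fin 4) (Fin 4) ℂ)

/-- The Dirac matrix `β = [[I₂,0],[0,−I₂]]`. -/
def diracBeta : Matrix (Fin 4) (Fin 4) ℂ :=
  (Matrix.reindex finSumFinEquiv finSumFinEquiv
    (Matrix.fromBlocks (1 : Matrix (Fin 2) (Fin 2) ℂ) 0 0 (-1 : Matrix (Fin 2) (Fin 2) ℂ)) : Matrix (Fin 4) (Fin 4) ℂ)

/-- The matrix `γ₅ = [[0,I₂],[I₂,0]]`. -/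
def gamma5 : Matrix (Fin 4) (Fin 4) ℂ :=
  (Matrix.reindex finSumFinEquiv finSumFinEquiv
    (Matrix.fromBlocks (0 : Matrix (Fin 2) (Fin 2) ℂ) 1 1 (0 : Matrix (Fin 2) (Fin 2) ℂ)) : Matrix (Fin 4) (Fin 4) ℂ)

/-- `α·a = a₁α₁ + a₂α₂ + a₃α₃` for a real vector `a`. -/
def alphaD (a : Fin 3 → ℝ) : Matrix (Fin 4) (Fin 4) ℂ :=
  ∑ k, (a k : ℂ) • diracAlpha k

/-- The partial derivative `∂ₖ` of a spinor field. -/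
def pd (k : Fin 3) (u : R3 → Spinor) (x : R3) : Spinor :=
  fderiv ℝ u x (EuclideanSpace.single k 1)

/-- The free Dirac operator `𝒟 = −i Σₖ αₖ ∂ₖ`. -/
def diracOp (u : R3 → Spinor) (x : R3) : Spinor :=
  (-Complex.I) • ∑ k, (diracAlpha k).mulVec (pd k u x)

/-- The symbol `cos(t|ξ|)I₄ + i sin(t|ξ|)(α·ξ)/|ξ|` of the free Dirac propagator. -/
def diracSymb (t : ℝ) (ξ : R3) : Matrix (Fin 4) (Fin 4) ℂ :=
  (Real.cos (t * ‖ξ‖) : ℂ) • 1 +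
    (Complex.I * (Real.sin (t * ‖ξ‖) : ℂ) / (‖ξ‖ : ℂ)) • alphaD (fun k => ξ k)

/-- The free Dirac propagator `e^{it𝒟}`, as the Fourier multiplier with matrix symbol
`cos(t|ξ|)I₄ + i sin(t|ξ|)(α·ξ)/|ξ|`. -/
def diracProp (t : ℝ) (f : R3 → Spinor) : R3 → Spinor :=
  𝓕⁻ fun ξ => (diracSymb t ξ).mulVec (𝓕 f ξ)

/-- The homogeneous Sobolev norm `‖f‖_{Ḣˢ} = ‖ |ξ|ˢ f̂(ξ) ‖_{L²}`. -/
def hSob (s : ℝ) (f : R3 → Spinor) : ℝ≥0∞ :=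
  eLpNorm (fun ξ : R3 => ‖ξ‖ ^ s • 𝓕 f ξ) 2 volume

/-- The mixed norm `‖u‖_{L²_t L^∞_x}`. -/
def L2Linf (u : ℝ → R3 → Spinor) : ℝ≥0∞ :=
  (∫⁻ t : ℝ, (eLpNorm (u t) ⊤ volume) ^ 2) ^ (1/2 : ℝ)

/-- The mixed norm `‖u‖_{L²_t L²_x}`. -/
def L2L2 (u : ℝ → R3 → Spinor) : ℝ≥0∞ :=
  (∫⁻ t : ℝ, (eLpNorm (u t) 2 volume) ^ 2) ^ (1/2 : ℝ)

/-- A function on `ℝ³` is radial if it depends only on `|x|`. -/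
def IsRadial {E : Type*} (f : R3 → E) : Prop :=
  ∀ x y : R3, ‖x‖ = ‖y‖ → f x = f y

/-- The class `𝓗̇¹`: `f = f₁ + 𝒟f₂` with `f₁ ∈ Ḣ¹`, `f₂ ∈ Ḣ²`, componentwise radial. -/
def Hclass (f : R3 → Spinor) : Prop :=
  ∃ f₁ f₂ : R3 → Spinor,
    (∀ j, IsRadial fun x => f₁ x j) ∧ (∀ j, IsRadial fun x => f₂ x j) ∧
    hSob 1 f₁ < ⊤ ∧ hSob 2 f₂ < ⊤ ∧ f = f₁ + fun x => diracOp f₂ x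

/-- The potential `V(x) = V₁(|x|)I₄ + iβ(α·x̂)V₂(|x|)`. -/
def potential (V₁ V₂ : ℝ → ℝ) (x : R3) : Matrix (Fin 4) (Fin 4) ℂ :=
  (V₁ ‖x‖ : ℂ) • 1 +
    (Complex.I * (V₂ ‖x‖ : ℂ)) • (diracBeta * alphaD fun k => ‖x‖⁻¹ * x k)

/-- The size assumption `|V(x)| ≤ δ/(|x|^{1/2}|log|x||^{σ/2} + |x|^σ)`. -/
def VBound (σ δ : ℝ) (V : R3 → Matrix (Fin 4) (Fin 4) ℂ) : Prop :=
  ∀ x : R3, x ≠ 0 →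
    ‖V x‖ ≤ δ / (‖x‖ ^ (1/2 : ℝ) * |Real.log ‖x‖| ^ (σ/2) + ‖x‖ ^ σ)


/-- The orbital angular momentum operator `L = x ∧ (−i∇)`, acting componentwise. -/
def angMom : Fin 3 → (R3 → Spinor) → R3 → Spinor
  | 0, u, x => (-Complex.I) • (x 1 • pd 2 u x - x 2 • pd 1 u x)
  | 1, u, x => (-Complex.I) • (x 2 • pd 0 u x - x 0 • pd 2 u x)
  | 2, u, x => (-Complex.I) • (x 0 • pd 1 u x - x 1 • pd 0 u x)

/-- The operator `2S·L = Σₖ γ₅αₖ Lₖ`. -/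
def twoSdotL (u : R3 → Spinor) (x : R3) : Spinor :=
  ∑ k, (gamma5 * diracAlpha k).mulVec (angMom k u x)

/-- The spin orbit operator `K = β(2S·L + 1)`. -/
def Kop (u : R3 → Spinor) (x : R3) : Spinor :=
  diracBeta.mulVec (twoSdotL u x + u x)

lemma diracBeta_mul_self : diracBeta * diracBeta = 1 := by
  simp [diracBeta, Matrix.fromBlocks_multiply]

lemma diracAlpha_zero :
    diracAlpha 0 = !![0, 0, 0, 1; 0, 0, 1, 0; 0, 1, 0, 0; 1, 0, 0, 0] := by
  ext i j; fin_cases i <;> fin_cases j <;> rfl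

lemma diracAlpha_one :
    diracAlpha 1 = !![0, 0, 0, -Complex.I; 0, 0, Complex.I, 0;
      0, -Complex.I, 0, 0; Complex.I, 0, 0, 0] := by
  ext i j; fin_cases i <;> fin_cases j <;> rfl

lemma diracAlpha_two :
    diracAlpha 2 = !![0, 0, 1, 0; 0, 0, 0, -1; 1, 0, 0, 0; 0, -1, 0, 0] := by
  ext i j; fin_cases i <;> fin_cases j <;> rfl

lemma gamma5_eq :
    gamma5 = !![0, 0, 1, 0; 0, 0, 0, 1; 1, 0, 0, 0; 0, 1, 0, 0] := by
  ext i j; fin_cases i <;> fin_cases j <;> rfl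

/-- The square of `α·a` is `|a|²`. -/
lemma alphaD_mul_self (a : Fin 3 → ℝ) :
    alphaD a * alphaD a = ((∑ k, a k ^ 2 : ℝ) : ℂ) • 1 := by
  ext i j
  fin_cases i <;> fin_cases j <;>
    simp [alphaD, Fin.sum_univ_three, diracAlpha_zero, diracAlpha_one, diracAlpha_two,
      Matrix.mul_apply, Fin.sum_univ_four] <;>
    ring_nf <;> simp

/-- The Euler operator splits as `x·∇ = (α·x)(α·∇) + 2S·L`. -/
lemma sum_smul_pd (u : R3 → Spinor) (x : R3) :
    ∑ k, x k • pd k u x =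
      (alphaD fun k => x k).mulVec (∑ k, (diracAlpha k).mulVec (pd k u x)) + twoSdotL u x := by
  ext i
  fin_cases i <;>
    simp [alphaD, twoSdotL, angMom, gamma5_eq, Fin.sum_univ_three, diracAlpha_zero,
      diracAlpha_one, diracAlpha_two, dotProduct, Fin.sum_univ_four] <;>
    ring_nf <;> simp

lemma fderiv_self_eq_sum_smul_pd (u : R3 → Spinor) (x : R3) :
    fderiv ℝ u x x = ∑ k, x k • pd k u x := by
  conv_lhs => enter [2]; rw [← (EuclideanSpace.basisFun (Fin 3) ℝ).sum_repr x]
  simp [pd]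

lemma alphaD_smul (c : ℝ) (a : Fin 3 → ℝ) : (alphaD fun k => c * a k) = (c : ℂ) • alphaD a := by
  simp [alphaD, Finset.smul_sum, mul_smul]

/-- The Dirac operator in polar coordinates:
`𝒟u = −i(α·x̂)(∂ᵣu + u/|x| − (1/|x|)βKu)`. -/
theorem dirac_polar_coordinates (u : R3 → Spinor)
    (hu : ContDiffOn ℝ 1 u {x : R3 | x ≠ 0}) (x : R3) (hx : x ≠ 0) :
    diracOp u x =
      (-Complex.I) • (alphaD fun k => ‖x‖⁻¹ * x k).mulVec
        (fderiv ℝ u x (‖x‖⁻¹ • x) + ‖x‖⁻¹ • u x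
          - ‖x‖⁻¹ • diracBeta.mulVec (Kop u x)) := by
  have hnorm : ∑ k, x k ^ 2 = ‖x‖ ^ 2 := (EuclideanSpace.real_norm_sq_eq x).symm
  have hr : (‖x‖ : ℂ) ≠ 0 := by simpa using hx
  have hβK : diracBeta.mulVec (Kop u x) = twoSdotL u x + u x := by
    rw [Kop, Matrix.mulVec_mulVec, diracBeta_mul_self, Matrix.one_mulVec]
  have hvec : fderiv ℝ u x (‖x‖⁻¹ • x) + ‖x‖⁻¹ • u x - ‖x‖⁻¹ • diracBeta.mulVec (Kop u x) =
      (‖x‖⁻¹ : ℂ) • (alphaD fun k => x k).mulVec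
        (∑ k, (diracAlpha k).mulVec (pd k u x)) := by
    rw [hβK, map_smul, fderiv_self_eq_sum_smul_pd, sum_smul_pd, ← Complex.ofReal_inv,
      Complex.coe_smul]
    module
  rw [hvec, alphaD_smul, Matrix.mulVec_smul, Matrix.smul_mulVec, Matrix.mulVec_mulVec,
    alphaD_mul_self, hnorm, Matrix.smul_mulVec, Matrix.one_mulVec, diracOp]
  simp only [smul_smul]
  congr 1
  push_cast
  field_simp
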